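/- Let X, X' be metric spaces with X locally connected and X' locally compact, D a domain in X with compact closure, and f : D → D' ⊆ X' a continuous, discrete, open and closed map. Then every path β : [a, b) → D' with β(a) ∈ f(D) admits, for each x ∈ f⁻¹(β(a)), a whole f-lifting α : [a, b) → D starting at x, i.e. α(a) = x and f ∘ α = β on [a, b). Moreover, if β(t) → B₀ ∈ D' as t → b⁻, then α extends continuously to b with f(α(b)) = B₀. -/

import Mathlib

open Set Topology Filter

/-- `g` selects a point of `F t` for every `t ∈ [a, c]`, starts at `x`, and has jumps smaller
than `ε`. -/
structure IsApproxSelection {X : Type*} [MetricSpace X] (F : ℝ → Set X) (ε a c : ℝ) (x : X)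
    (g : ℝ → X) : Prop where
  start : g a = x
  mem : ∀ t ∈ Icc a c, g t ∈ F t
  jump : ∀ t ∈ Icc a c, ∀ᶠ u in 𝓝[Icc a c] t, dist (g u) (g t) < ε

namespace IsApproxSelection

variable {X : Type*} [MetricSpace X] {F : ℝ → Set X} {ε a c s t : ℝ} {x : X} {g : ℝ → X}

theorem mono (hg : IsApproxSelection F ε a t x g) (hst : s ≤ t) :
    IsApproxSelection F ε a s x g where
  start := hg.start
  mem u hu := hg.mem u (Icc_subset_Icc_right hst hu)
  jump u hu := nhdsWithin_mono u (Icc_subset_Icc_right hst)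
    (hg.jump u (Icc_subset_Icc_right hst hu))

theorem exists_extend (hg : IsApproxSelection F ε a s x g) (has : a ≤ s)
    (h : ∀ u ∈ Ioc s t, ∃ e ∈ F u, dist e (g s) < ε / 2) :
    ∃ g', IsApproxSelection F ε a t x g' := by
  have : Nonempty X := ⟨x⟩
  choose! k hkF hk using h
  refine ⟨fun u => if u ≤ s then g u else k u, ?_, ?_, ?_⟩
  · simp [has, hg.start]
  · intro u hu
    by_cases hus : u ≤ s
    · simpa [hus] using hg.mem u ⟨hu.1, hus⟩
    · simpa [hus] using hkF u ⟨not_le.1 hus, hu.2⟩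
  · intro v hv
    rw [eventually_nhdsWithin_iff]
    rcases lt_trichotomy v s with hvs | rfl | hvs
    · have h1 := eventually_nhdsWithin_iff.1 (hg.jump v ⟨hv.1, hvs.le⟩)
      filter_upwards [h1, Iio_mem_nhds hvs] with u hu hus hut
      simpa [hvs.le, (mem_Iio.1 hus).le] using hu ⟨hut.1, (mem_Iio.1 hus).le⟩
    · have h1 := eventually_nhdsWithin_iff.1 (hg.jump v ⟨hv.1, le_rfl⟩)
      filter_upwards [h1] with u hu hut
      by_cases huv : u ≤ v
      · simpa [huv] using hu ⟨hut.1, huv⟩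
      · have h2 := hk u ⟨not_le.1 huv, hut.2⟩
        have h3 : 0 ≤ dist (k u) (g v) := dist_nonneg
        simp only [huv, le_refl, if_true, if_false]
        linarith
    · filter_upwards [Ioi_mem_nhds hvs] with u hus hut
      have h2 := hk u ⟨hus, hut.2⟩
      have h3 := hk v ⟨hvs, hv.2⟩
      simp only [not_le.2 hvs, not_le.2 (mem_Ioi.1 hus), if_false]
      linarith [dist_triangle_right (k u) (k v) (g s)]

/-- If over an interval the values of `F` lie in the `r`-balls around a finite `3 * r`-separated
set, an approximate selection with jumps smaller than `r` stays in one of these balls. -/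
theorem dist_lt_of_separated {J : Set ℝ} {E : Set X} {r : ℝ} {e : X}
    (hg : IsApproxSelection F r a c x g) (hJ : IsPreconnected J) (hJc : J ⊆ Icc a c)
    (hE : ∀ p ∈ E, ∀ q ∈ E, p ≠ q → 3 * r ≤ dist p q)
    (hF : ∀ u ∈ J, ∀ p ∈ F u, ∃ q ∈ E, dist p q < r) (he : e ∈ E)
    (hs : s ∈ J) (ht : t ∈ J) (hse : dist (g s) e < r) : dist (g t) e < r := by
  have hP : (dist (g s) e < r ↔ dist (g t) e < r) := by
    refine hJ.induction₂ (fun u v => (dist (g u) e < r ↔ dist (g v) e < r)) ?_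
      (fun _ _ _ _ _ _ h h' => h.trans h') (fun _ _ _ _ h => h.symm) hs ht
    intro u hu
    filter_upwards [nhdsWithin_mono u hJc (hg.jump u (hJc hu)), self_mem_nhdsWithin] with v hv hvJ
    have key : ∀ w ∈ J, ∀ w' : X, dist (g w) w' < r → dist w' e < r → dist (g w) e < r := by
      intro w hw w' hww' hw'
      obtain ⟨q, hq, hwq⟩ := hF w hw _ (hg.mem w (hJc hw))
      by_cases hqe : q = e
      · rwa [← hqe]
      · have h1 := hE q hq e he hqe
        have h2 := dist_triangle4 q (g w) w' e
        rw [dist_comm q (g w)] at h2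
        linarith
    exact ⟨key v hvJ _ hv, key u hu _ (by rwa [dist_comm])⟩
  exact hP.1 hse

end IsApproxSelection

section Selection

variable {X : Type*} [MetricSpace X] {F : ℝ → Set X} {I : Set ℝ} {a : ℝ} {x : X}

theorem exists_isApproxSelection (hI : I.OrdConnected)
    (haI : a ∈ I) (hfin : ∀ t ∈ I, (F t).Finite)
    (husc : ∀ t ∈ I, ∀ W, IsOpen W → F t ⊆ W → ∀ᶠ s in 𝓝[I] t, F s ⊆ W)
    (hlsc : ∀ t ∈ I, ∀ e ∈ F t, ∀ ε > 0, ∀ᶠ s in 𝓝[I] t, ∃ e' ∈ F s, dist e' e < ε)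
    (hx : x ∈ F a) {ε : ℝ} (hε : 0 < ε) {c : ℝ} (hc : c ∈ I) (hac : a ≤ c) :
    ∃ g, IsApproxSelection F ε a c x g := by
  have hIc : Icc a c ⊆ I := hI.out haI hc
  have hP : (∃ g, IsApproxSelection F ε a a x g) ↔ ∃ g, IsApproxSelection F ε a c x g := by
    refine isPreconnected_Icc.induction₂ (s := Icc a c)
      (fun s t => (∃ g, IsApproxSelection F ε a s x g) ↔ ∃ g, IsApproxSelection F ε a t x g) ?_
      (fun _ _ _ _ _ _ h h' => h.trans h') (fun _ _ _ _ h => h.symm)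
      (left_mem_Icc.2 hac) (right_mem_Icc.2 hac)
    intro t ht
    have hI' : ∀ᶠ s in 𝓝[I] t, (F s ⊆ ⋃ e ∈ F t, Metric.ball e (ε / 4)) ∧
        ∀ e ∈ F t, ∃ e' ∈ F s, dist e' e < ε / 4 := by
      refine (husc t (hIc ht) _ (isOpen_biUnion fun _ _ => Metric.isOpen_ball) ?_).and ?_
      · exact fun e he => mem_biUnion he (Metric.mem_ball_self (by positivity))
      · exact ((hfin t (hIc ht)).eventually_all).2 fun e he =>
          hlsc t (hIc ht) e he _ (by positivity)
    obtain ⟨δ, hδ, hδI⟩ := Metric.mem_nhdsWithin_iff.1 hI'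
    have hball : Metric.ball t δ ∩ Icc a c ∈ 𝓝[Icc a c] t :=
      inter_mem (mem_nhdsWithin_of_mem_nhds (Metric.ball_mem_nhds t hδ)) self_mem_nhdsWithin
    have htδ : t ∈ Metric.ball t δ := Metric.mem_ball_self hδ
    have hconv : (Metric.ball t δ ∩ Icc a c).OrdConnected := by
      rw [Real.ball_eq_Ioo]
      exact ordConnected_Ioo.inter ordConnected_Icc
    have key : ∀ s ∈ Metric.ball t δ ∩ Icc a c, ∀ s' ∈ Metric.ball t δ ∩ Icc a c,
        (∃ g, IsApproxSelection F ε a s x g) → ∃ g, IsApproxSelection F ε a s' x g := by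
      rintro s hs s' hs' ⟨g, hg⟩
      rcases le_total s' s with hss | hss
      · exact ⟨g, hg.mono hss⟩
      · refine hg.exists_extend hs.2.1 fun u hu => ?_
        have hu' := hconv.out hs hs' (Ioc_subset_Icc_self hu)
        have h1 := (hδI ⟨hs.1, hIc hs.2⟩).1 (hg.mem s ⟨hs.2.1, le_rfl⟩)
        simp only [mem_iUnion, Metric.mem_ball] at h1
        obtain ⟨e, he, hge⟩ := h1
        obtain ⟨e', he', hee⟩ := (hδI ⟨hu'.1, hIc hu'.2⟩).2 e he
        exact ⟨e', he', by linarith [dist_triangle_right e' (g s) e]⟩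
    filter_upwards [hball] with s hs
    exact ⟨key t ⟨htδ, ht⟩ s hs, key s hs t ⟨htδ, ht⟩⟩
  refine hP.1 ⟨fun _ => x, rfl, ?_, ?_⟩
  · intro t ht
    rw [Icc_self, mem_singleton_iff] at ht
    rwa [ht]
  · simp [hε]

/-- A continuous multifunction with finite values on an interval has a continuous selection
through every point over the left endpoint. -/
theorem exists_continuousOn_selection (hI : I.OrdConnected)
    (haI : a ∈ I) (haI' : ∀ t ∈ I, a ≤ t) (hfin : ∀ t ∈ I, (F t).Finite)
    (husc : ∀ t ∈ I, ∀ W, IsOpen W → F t ⊆ W → ∀ᶠ s in 𝓝[I] t, F s ⊆ W)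
    (hlsc : ∀ t ∈ I, ∀ e ∈ F t, ∀ ε > 0, ∀ᶠ s in 𝓝[I] t, ∃ e' ∈ F s, dist e' e < ε)
    (hx : x ∈ F a) :
    ∃ α : ℝ → X, ContinuousOn α I ∧ α a = x ∧ ∀ t ∈ I, α t ∈ F t := by
  have hex : ∀ i : I × ℕ, ∃ g, IsApproxSelection F (1 / ((i.2 : ℝ) + 1)) a i.1 x g := fun i =>
    exists_isApproxSelection hI haI hfin husc hlsc hx (by positivity) i.1.2 (haI' _ i.1.2)
  choose g hg using hex
  have : Nonempty I := ⟨⟨a, haI⟩⟩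
  let U : Ultrafilter (I × ℕ) := Ultrafilter.of atTop
  have hU : (U : Filter (I × ℕ)) ≤ atTop := Ultrafilter.of_le _
  have hle : ∀ t ∈ I, ∀ᶠ i in (U : Filter (I × ℕ)), t ≤ i.1 := fun t ht =>
    hU (by filter_upwards [eventually_ge_atTop ((⟨t, ht⟩, 0) : I × ℕ)] with i hi using hi.1)
  have hlim : ∀ t ∈ I, ∃ e ∈ F t, ∀ᶠ i in (U : Filter (I × ℕ)), g i t = e := by
    intro t ht
    refine (Ultrafilter.eventually_exists_mem_iff (hfin t ht)).1 ?_
    filter_upwards [hle t ht] with i hi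
    exact ⟨_, (hg i).mem t ⟨haI' t ht, hi⟩, rfl⟩
  have : Nonempty X := ⟨x⟩
  choose! α hαF hα using hlim
  refine ⟨α, ?_, ?_, hαF⟩
  · intro t ht
    rw [ContinuousWithinAt, Metric.tendsto_nhds]
    intro ε hε
    obtain ⟨r, hr, hrε, hsep⟩ : ∃ r > 0, r ≤ ε ∧
        ∀ p ∈ F t, ∀ q ∈ F t, p ≠ q → 3 * r ≤ dist p q := by
      have h1 : ∀ p ∈ F t, ∀ q ∈ F t, ∀ᶠ r in 𝓝[>] (0 : ℝ), p ≠ q → 3 * r ≤ dist p q := by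
        intro p _ q _
        by_cases hpq : p = q
        · simp [hpq]
        · have : 0 < dist p q / 3 := by have := dist_pos.2 hpq; positivity
          filter_upwards [Ioo_mem_nhdsGT this] with r hr _
          linarith [hr.2]
      have h2 : ∀ᶠ r in 𝓝[>] (0 : ℝ), ∀ p ∈ F t, ∀ q ∈ F t, p ≠ q → 3 * r ≤ dist p q :=
        ((hfin t ht).eventually_all).2 fun p hp =>
          ((hfin t ht).eventually_all).2 fun q hq => h1 p hp q hq
      obtain ⟨r, hr, hr'⟩ := (h2.and (Ioo_mem_nhdsGT hε)).exists
      exact ⟨r, hr'.1, hr'.2.le, hr⟩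
    have hW : ∀ᶠ s in 𝓝[I] t, F s ⊆ ⋃ e ∈ F t, Metric.ball e r :=
      husc t ht _ (isOpen_biUnion fun _ _ => Metric.isOpen_ball)
        fun e he => mem_biUnion he (Metric.mem_ball_self hr)
    obtain ⟨δ, hδ, hδI⟩ := Metric.mem_nhdsWithin_iff.1 hW
    have hconv : (Metric.ball t δ ∩ I).OrdConnected := by
      rw [Real.ball_eq_Ioo]
      exact ordConnected_Ioo.inter hI
    have htδ : t ∈ Metric.ball t δ ∩ I := ⟨Metric.mem_ball_self hδ, ht⟩
    have hball : Metric.ball t δ ∩ I ∈ 𝓝[I] t :=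
      inter_mem (mem_nhdsWithin_of_mem_nhds (Metric.ball_mem_nhds t hδ)) self_mem_nhdsWithin
    filter_upwards [hball] with s hs
    have hn : ∀ᶠ i in (U : Filter (I × ℕ)), 1 / ((i.2 : ℝ) + 1) < r := by
      obtain ⟨n, hn⟩ := exists_nat_one_div_lt hr
      refine hU ?_
      filter_upwards [eventually_ge_atTop ((⟨t, ht⟩, n) : I × ℕ)] with i hi
      exact (one_div_le_one_div_of_le (by positivity) (by
        have : (n : ℝ) ≤ i.2 := Nat.cast_le.2 hi.2
        linarith)).trans_lt hn
    obtain ⟨i, hir, his, hit, hgs, hgt⟩ := (hn.and ((hle s hs.2).and ((hle t ht).and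
      ((hα s hs.2).and (hα t ht))))).exists
    have hgr : IsApproxSelection F r a i.1 x (g i) :=
      ⟨(hg i).start, (hg i).mem, fun u hu => ((hg i).jump u hu).mono fun _ h => h.trans hir⟩
    have hJ : uIcc t s ⊆ Metric.ball t δ ∩ I := hconv.uIcc_subset htδ hs
    have := hgr.dist_lt_of_separated (J := uIcc t s) (E := F t) (e := α t) (s := t) (t := s)
      isPreconnected_uIcc
      (fun u hu => ⟨haI' u (hJ hu).2, hu.2.trans (sup_le hit his)⟩) hsep
      (fun u hu p hp => by simpa using hδI (hJ hu) hp) (hαF t ht)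
      left_mem_uIcc right_mem_uIcc (by simpa [hgt] using hr)
    rw [hgs] at this
    exact this.trans_le hrε
  · obtain ⟨i, hi⟩ := (hα a haI).exists
    rw [← hi, (hg i).start]

end Selection

section ClosedMap

variable {X X' : Type*} [MetricSpace X] [MetricSpace X'] {D : Set X} {D' : Set X'} {f : X → X'}

/-- The fibers of a discrete closed map on a domain are finite. -/
theorem finite_fiber_of_discrete_of_closed (hD_open : IsOpen D) (hD_conn : IsConnected D)
    (hf_cont : ContinuousOn f D)
    (hf_discrete : ∀ y : X', ∀ x ∈ D, ¬ AccPt x (𝓟 (D ∩ f ⁻¹' {y})))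
    (hf_closed : ∀ C ⊆ D, (∃ F : Set X, IsClosed F ∧ C = F ∩ D) →
      ∃ B : Set X', IsClosed B ∧ f '' C = B ∩ D')
    {y : X'} (hy : y ∈ D') : (D ∩ f ⁻¹' {y}).Finite := by
  by_contra hinf
  have hinf : (D ∩ f ⁻¹' {y}).Infinite := hinf
  have hperf : Preperfect D :=
    hD_conn.isPreconnected.preperfect_of_nontrivial (hinf.nontrivial.mono inter_subset_left)
  have hnear : ∀ p ∈ D ∩ f ⁻¹' {y}, ∀ ε > 0,
      ∃ z ∈ D, f z ≠ y ∧ dist z p < ε ∧ dist (f z) y < ε := by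
    intro p hp ε hε
    have h1 := accPt_iff_frequently.1 (hperf p hp.1)
    have h2 := not_frequently.1 (mt accPt_iff_frequently.2 (hf_discrete y p hp.1))
    have h3 := (hf_cont.continuousAt (hD_open.mem_nhds hp.1)).eventually
      (Metric.ball_mem_nhds _ hε)
    obtain ⟨z, ⟨hzp, hzD⟩, h2, h3, h4⟩ :=
      (h1.and_eventually (h2.and (h3.and (Metric.ball_mem_nhds p hε)))).exists
    refine ⟨z, hzD, fun hzy => h2 ⟨hzp, hzD, hzy⟩, h4, ?_⟩
    rwa [← show f p = y from hp.2]
  let p : ℕ ↪ ↥(D ∩ f ⁻¹' {y}) := hinf.natEmbedding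
  choose z hzD hzy hzp hfz using fun n : ℕ =>
    hnear (p n) (p n).2 (1 / ((n : ℝ) + 1)) (by positivity)
  obtain ⟨B, hB, hfB⟩ := hf_closed (closure (range z) ∩ D) inter_subset_right
    ⟨_, isClosed_closure, rfl⟩
  have hzB : ∀ n, f (z n) ∈ B := fun n => by
    have : f (z n) ∈ f '' (closure (range z) ∩ D) :=
      mem_image_of_mem f ⟨subset_closure (mem_range_self n), hzD n⟩
    exact (hfB ▸ this).1
  have hlim : Tendsto (fun n => f (z n)) atTop (𝓝 y) :=
    tendsto_iff_dist_tendsto_zero.2 (squeeze_zero (fun _ => dist_nonneg) (fun n => (hfz n).le)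
      tendsto_one_div_add_atTop_nhds_zero_nat)
  have hyB : y ∈ f '' (closure (range z) ∩ D) :=
    hfB ▸ ⟨hB.mem_of_tendsto hlim (Eventually.of_forall hzB), hy⟩
  obtain ⟨w, ⟨hw, hwD⟩, hwy⟩ := hyB
  have h2 := not_frequently.1 (mt accPt_iff_frequently.2 (hf_discrete y w hwD))
  obtain ⟨r, hr, hrw⟩ := Metric.eventually_nhds_iff.1 h2
  have hpw : ∀ᶠ n in atTop, (p n : X) ≠ w := by
    rw [← Nat.cofinite_eq_atTop]
    exact (Subtype.val_injective.comp p.injective).tendsto_cofinite.eventually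
      (eventually_cofinite_ne w)
  have hfar : ∀ᶠ n in atTop, r / 2 ≤ dist (z n) w := by
    have h3 : ∀ᶠ n : ℕ in atTop, 1 / ((n : ℝ) + 1) < r / 2 :=
      tendsto_one_div_add_atTop_nhds_zero_nat.eventually_lt_const (by positivity)
    filter_upwards [hpw, h3] with n hn hn'
    by_contra hlt
    refine hrw (y := p n) ?_ ⟨hn, (p n).2⟩
    linarith [dist_triangle_left (p n : X) w (z n), hzp n]
  rw [← Nat.cofinite_eq_atTop] at hfar
  have hclosed : IsClosed (z '' {n | ¬ r / 2 ≤ dist (z n) w}) := (hfar.image z).isClosed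
  have hwn : w ∉ z '' {n | ¬ r / 2 ≤ dist (z n) w} := by
    rintro ⟨n, -, hn⟩
    exact hzy n (hn ▸ hwy)
  obtain ⟨v, ⟨hv1, hv2⟩, n, rfl⟩ := mem_closure_iff_nhds.1 hw _
    (inter_mem (hclosed.isOpen_compl.mem_nhds hwn) (Metric.ball_mem_nhds w (half_pos hr)))
  exact hv1 ⟨n, not_le.2 hv2, rfl⟩

/-- Lifting of paths, parametrized by any interval with a least element, under a continuous,
discrete, open and closed map of a domain. -/
theorem exists_continuousOn_lift (hD_open : IsOpen D) (hD_conn : IsConnected D)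
    (hf_cont : ContinuousOn f D)
    (hf_discrete : ∀ y : X', ∀ x ∈ D, ¬ AccPt x (𝓟 (D ∩ f ⁻¹' {y})))
    (hf_open : ∀ U ⊆ D, IsOpen U → ∃ V : Set X', IsOpen V ∧ f '' U = V ∩ D')
    (hf_closed : ∀ C ⊆ D, (∃ F : Set X, IsClosed F ∧ C = F ∩ D) →
      ∃ B : Set X', IsClosed B ∧ f '' C = B ∩ D')
    {I : Set ℝ} {a : ℝ} (hI : I.OrdConnected) (haI : a ∈ I) (haI' : ∀ t ∈ I, a ≤ t)
    {β : ℝ → X'} (hβ_cont : ContinuousOn β I) (hβ_in : ∀ t ∈ I, β t ∈ D')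
    {x : X} (hx : x ∈ D) (hfx : f x = β a) :
    ∃ α : ℝ → X, ContinuousOn α I ∧ α a = x ∧ ∀ t ∈ I, α t ∈ D ∧ f (α t) = β t := by
  refine exists_continuousOn_selection (F := fun t => D ∩ f ⁻¹' {β t}) hI haI haI' ?_ ?_ ?_
    ⟨hx, hfx⟩
  · exact fun t ht => finite_fiber_of_discrete_of_closed hD_open hD_conn hf_cont hf_discrete
      hf_closed (hβ_in t ht)
  · intro t ht W hW hFW
    obtain ⟨B, hB, hfB⟩ := hf_closed (Wᶜ ∩ D) inter_subset_right ⟨_, hW.isClosed_compl, rfl⟩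
    have htB : β t ∉ B := fun h => by
      obtain ⟨e, ⟨heW, heD⟩, he⟩ : β t ∈ f '' (Wᶜ ∩ D) := hfB ▸ ⟨h, hβ_in t ht⟩
      exact heW (hFW ⟨heD, he⟩)
    filter_upwards [(hβ_cont t ht).eventually (hB.isOpen_compl.mem_nhds htB),
      self_mem_nhdsWithin] with s hs hsI e he
    by_contra heW
    have : f e ∈ f '' (Wᶜ ∩ D) := mem_image_of_mem f ⟨heW, he.1⟩
    rw [hfB, he.2] at this
    exact hs this.1
  · intro t ht e he ε hε
    obtain ⟨V, hV, hfV⟩ := hf_open (Metric.ball e ε ∩ D) inter_subset_right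
      (Metric.isOpen_ball.inter hD_open)
    have htV : β t ∈ V := by
      have : f e ∈ f '' (Metric.ball e ε ∩ D) :=
        mem_image_of_mem f ⟨Metric.mem_ball_self hε, he.1⟩
      rw [hfV, he.2] at this
      exact this.1
    filter_upwards [(hβ_cont t ht).eventually (hV.mem_nhds htV), self_mem_nhdsWithin] with s hs hsI
    obtain ⟨e', ⟨he', heD⟩, hfe⟩ : β s ∈ f '' (Metric.ball e ε ∩ D) := hfV ▸ ⟨hs, hβ_in s hsI⟩
    exact ⟨e', ⟨heD, hfe⟩, he'⟩

end ClosedMap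

/-- Whole lifting of paths under a continuous, discrete, open, closed map of a
domain with compact closure; moreover the lifting extends to the endpoint if
the path has a limit in `D'`. -/
theorem whole_lifting_exists
    {X X' : Type*} [MetricSpace X] [MetricSpace X']
    [LocallyConnectedSpace X] [LocallyCompactSpace X']
    (D : Set X) (D' : Set X') (f : X → X')
    (hD_open : IsOpen D) (hD_conn : IsConnected D)
    (hD_cpt : IsCompact (closure D))
    (hf_cont : ContinuousOn f D) (hf_onto : f '' D = D')
    (hf_discrete : ∀ y : X', ∀ x ∈ D, ¬ AccPt x (𝓟 (D ∩ f ⁻¹' {y})))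
    (hf_open : ∀ U ⊆ D, IsOpen U → ∃ V : Set X', IsOpen V ∧ f '' U = V ∩ D')
    (hf_closed : ∀ C ⊆ D, (∃ F : Set X, IsClosed F ∧ C = F ∩ D) →
      ∃ B : Set X', IsClosed B ∧ f '' C = B ∩ D')
    (a b : ℝ) (hab : a < b) (β : ℝ → X')
    (hβ_cont : ContinuousOn β (Set.Ico a b))
    (hβ_in : ∀ t ∈ Set.Ico a b, β t ∈ D')
    (x : X) (hx : x ∈ D) (hfx : f x = β a) :
    ∃ α : ℝ → X, ContinuousOn α (Set.Ico a b) ∧ α a = x ∧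
      (∀ t ∈ Set.Ico a b, α t ∈ D ∧ f (α t) = β t) ∧
      ∀ B₀ ∈ D', Filter.Tendsto β (𝓝[<] b) (𝓝 B₀) →
        ∃ A ∈ D, Filter.Tendsto α (𝓝[<] b) (𝓝 A) ∧ f A = B₀ := by
  by_cases hlim : ∃ B₀ ∈ D', Tendsto β (𝓝[<] b) (𝓝 B₀)
  · obtain ⟨B₀, hB₀, hβ⟩ := hlim
    have hne : ∀ t ∈ Ico a b, t ≠ b := fun t ht => ht.2.ne
    obtain ⟨α, hα, hαa, hαf⟩ := exists_continuousOn_lift (I := Icc a b) (a := a)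
      (β := Function.update β b B₀) (x := x) hD_open hD_conn hf_cont hf_discrete hf_open hf_closed
      ordConnected_Icc (left_mem_Icc.2 hab.le) (fun t ht => ht.1)
      (by
        rw [continuousOn_update_iff, Icc_sdiff_right, nhdsWithin_Ico_eq_nhdsLT hab]
        exact ⟨hβ_cont, fun _ => hβ⟩)
      (fun t ht => by
        rcases eq_or_ne t b with rfl | htb
        · simpa using hB₀
        · simpa [htb] using hβ_in t ⟨ht.1, lt_of_le_of_ne ht.2 htb⟩)
      hx (by simpa [hab.ne] using hfx)
    refine ⟨α, hα.mono Ico_subset_Icc_self, hαa, fun t ht => ?_, fun B₁ _ hB₁ => ?_⟩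
    · simpa [hne t ht] using hαf t (Ico_subset_Icc_self ht)
    · have hb := hαf b (right_mem_Icc.2 hab.le)
      refine ⟨α b, hb.1, ?_, ?_⟩
      · rw [← nhdsWithin_Ico_eq_nhdsLT hab]
        exact (hα b (right_mem_Icc.2 hab.le)).mono_left
          (nhdsWithin_mono b Ico_subset_Icc_self)
      · rw [hb.2, Function.update_self, tendsto_nhds_unique hβ hB₁]
  · obtain ⟨α, hα, hαa, hαf⟩ := exists_continuousOn_lift hD_open hD_conn hf_cont hf_discrete
      hf_open hf_closed ordConnected_Ico (left_mem_Ico.2 hab) (fun t ht => ht.1) hβ_cont hβ_in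
      hx hfx
    exact ⟨α, hα, hαa, hαf, fun B₀ hB₀ hβ => (hlim ⟨B₀, hB₀, hβ⟩).elim⟩
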